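/- Let V be a finite-dimensional complex vector space carrying two Lie algebra structures g = (V, [·,·]) and n = (V, {·,·}), where g is a simple Lie algebra and n is arbitrary. If there exists a post-Lie algebra structure on the pair (g, n), then n is isomorphic to g as a Lie algebra. -/

import Mathlib

theorem pl_det_formula {n : ℕ} (M : ℂ → Matrix (Fin n) (Fin n) ℂ) (M' : Matrix (Fin n) (Fin n) ℂ)
    (t : ℂ) (h : ∀ i j, HasDerivAt (fun s => M s i j) (M' i j) t) :
    HasDerivAt (fun s => (M s).det) (∑ σ : Equiv.Perm (Fin n), (Equiv.Perm.sign σ : ℂ) *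
      ∑ i, (∏ j ∈ Finset.univ.erase i, M t (σ j) j) • M' (σ i) i) t := by
  have : (fun s => (M s).det) = fun s => ∑ σ : Equiv.Perm (Fin n),
      (Equiv.Perm.sign σ : ℂ) * ∏ i, M s (σ i) i := by
    ext s; rw [Matrix.det_apply']
  rw [this]
  apply HasDerivAt.fun_sum
  intro σ _
  apply HasDerivAt.const_mul
  apply HasDerivAt.fun_finsetProd
  intro i _
  exact h _ _

theorem pl_det_hasDerivAt_zero {n : ℕ} (M : ℂ → Matrix (Fin n) (Fin n) ℂ)
    (M' X : Matrix (Fin n) (Fin n) ℂ) (t : ℂ)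
    (h : ∀ i j, HasDerivAt (fun s => M s i j) (M' i j) t) (hX : M' = M t * X)
    (hX0 : X.trace = 0) :
    HasDerivAt (fun t => (M t).det) 0 t := by
  have h1 := pl_det_formula M M' t h
  have h2 := pl_det_formula (fun s => M t + s • M') M' 0 (by
    intro i j
    have := ((hasDerivAt_id (0:ℂ)).mul_const (M' i j)).const_add (M t i j)
    simpa using this)
  have h3 : HasDerivAt (fun s : ℂ => (M t + s • M').det) 0 0 := by
    have e : (fun s : ℂ => (M t + s • M').det) = fun s => (M t).det *
        (1 + X.trace * s + Polynomial.eval s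
          (1 + (Polynomial.X : Polynomial ℂ) • X.map Polynomial.C).det.divX.divX * s ^ 2) := by
      ext s
      rw [← Matrix.det_one_add_smul, ← Matrix.det_mul, hX, mul_add, mul_one, Matrix.mul_smul]
    rw [e, hX0]
    have h4 := (((1 + (Polynomial.X : Polynomial ℂ) • X.map Polynomial.C).det.divX.divX.hasDerivAt
      0).mul (hasDerivAt_pow 2 (0:ℂ))).const_add 1 |>.const_mul (M t).det
    refine (h4.congr_deriv (by simp)).congr_of_eventuallyEq ?_
    refine Filter.Eventually.of_forall fun s => ?_
    simp only [Pi.mul_apply, zero_mul, add_zero]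
  have h5 := h2.unique h3
  simp only [zero_smul, add_zero] at h5
  rw [h5] at h1
  exact h1

section
variable {V : Type*} [NormedAddCommGroup V] [NormedSpace ℂ V] [FiniteDimensional ℂ V]

theorem pl_const (f : ℂ → V) (h : ∀ t, HasDerivAt f 0 t) (t : ℂ) : f t = f 0 :=
  is_const_of_deriv_eq_zero (fun t => (h t).differentiableAt) (fun t => (h t).deriv) t 0

theorem pl_exp_zero (A : V →L[ℂ] V) (f : ℂ → V) (h : ∀ t, HasDerivAt f (A (f t)) t)
    (h0 : f 0 = 0) (t : ℂ) : f t = 0 := by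
  have : CompleteSpace V := FiniteDimensional.complete ℂ V
  have h1 : ∀ t, HasDerivAt (fun s : ℂ => NormedSpace.exp (s • (-A)) (f s)) 0 t := by
    intro t
    have := (hasDerivAt_exp_smul_const (-A) t).clm_apply (h t)
    convert this using 1
    simp
  have h2 := pl_const _ h1 t
  simp only [h0, map_zero] at h2
  have h3 : NormedSpace.exp (t • A) * NormedSpace.exp (t • (-A)) = 1 := by
    have : NormedAlgebra ℚ (V →L[ℂ] V) := NormedAlgebra.restrictScalars ℚ ℂ _
    rw [smul_neg, ← NormedSpace.exp_add_of_commute (Commute.neg_right (Commute.refl _))]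
    simp
  calc f t = (NormedSpace.exp (t • A) * NormedSpace.exp (t • (-A))) (f t) := by rw [h3]; rfl
    _ = 0 := by rw [mul_apply_eq_comp, h2, map_zero]

/-- solution of the affine linear ODE -/
theorem pl_exists_flow (A P : V →ₗ[ℂ] V) : ∃ φ : ℂ → V →ₗ[ℂ] V, φ 0 = LinearMap.id ∧
    ∀ x t, HasDerivAt (fun s => φ s x) (A (φ t x) - P x) t := by
  have : CompleteSpace V := FiniteDimensional.complete ℂ V
  let D : (V × V) →ₗ[ℂ] (V × V) := LinearMap.prod 0
    (A ∘ₗ LinearMap.snd ℂ V V - P ∘ₗ LinearMap.fst ℂ V V)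
  let D' : (V × V) →L[ℂ] (V × V) := LinearMap.toContinuousLinearMap D
  have hD' : ∀ z, D' z = (0, A z.2 - P z.1) := fun z => rfl
  have hE : ∀ (z : V × V) t, HasDerivAt (fun s : ℂ => NormedSpace.exp (s • D') z)
      (D' (NormedSpace.exp (t • D') z)) t := by
    intro z t
    have := (hasDerivAt_exp_smul_const' D' t).clm_apply (hasDerivAt_const t z)
    refine this.congr_deriv ?_
    rw [map_zero, add_zero]; rfl
  have hfst : ∀ (z : V × V) (t : ℂ), (NormedSpace.exp (t • D') z).1 = z.1 := by
    intro z t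
    have := pl_const (fun s : ℂ => (NormedSpace.exp (s • D') z).1) (fun t => by
      have := (hE z t).fst
      rwa [hD'] at this) t
    rw [this]; simp
  refine ⟨fun t => LinearMap.snd ℂ V V ∘ₗ (NormedSpace.exp (t • D') : (V × V) →L[ℂ] (V × V)) ∘ₗ
    LinearMap.prod LinearMap.id LinearMap.id, ?_, ?_⟩
  · ext x; simp
  · intro x t
    have := (hE (x, x) t).snd
    rw [hD'] at this
    simp only [hfst] at this
    exact this

theorem pl_flow_contra (p n b : V →ₗ[ℂ] V →ₗ[ℂ] V)
    (hanti : ∀ x y, n x y = - n y x)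
    (hjac : ∀ x y z, n x (n y z) = n (n x y) z + n y (n x z))
    (h1 : ∀ x y, b x y = p x y - p y x + n x y)
    (h2 : ∀ x y z, p (b x y) z = p x (p y z) - p y (p x z))
    (h3 : ∀ x y z, p x (n y z) = n (p x y) z + n y (p x z))
    (htb : ∀ x, LinearMap.trace ℂ V (b x) = 0)
    (htp : ∀ x, LinearMap.trace ℂ V (p x) = 0)
    (v : V) (q : V →ₗ[ℂ] ℂ) (hqn : ∀ u w, q (n u w) = 0) (hq : ∀ x, q x = q (p x v)) :
    q = 0 := by
  obtain ⟨φ, hφ0, hφ⟩ := pl_exists_flow (n v) (p.flip v)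
  simp only [LinearMap.flip_apply] at hφ
  have lin : ∀ (l : V →ₗ[ℂ] V) (f : ℂ → V) (f' : V) (t : ℂ), HasDerivAt f f' t →
      HasDerivAt (fun s => l (f s)) (l f') t := fun l f f' t h =>
    (LinearMap.toContinuousLinearMap l).hasFDerivAt.comp_hasDerivAt t h
  have linq : ∀ (l : V →ₗ[ℂ] ℂ) (f : ℂ → V) (f' : V) (t : ℂ), HasDerivAt f f' t →
      HasDerivAt (fun s => l (f s)) (l f') t := fun l f f' t h =>
    (LinearMap.toContinuousLinearMap l).hasFDerivAt.comp_hasDerivAt t h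
  let nc : V →L[ℂ] V →L[ℂ] V := LinearMap.toContinuousLinearMap
    ((LinearMap.toContinuousLinearMap : (V →ₗ[ℂ] V) ≃ₗ[ℂ] (V →L[ℂ] V)).toLinearMap ∘ₗ n)
  have bil : ∀ (f g : ℂ → V) (f' g' : V) (t : ℂ), HasDerivAt f f' t → HasDerivAt g g' t →
      HasDerivAt (fun s => n (f s) (g s)) (n f' (g t) + n (f t) g') t := by
    intro f g f' g' t hf hg
    have := (nc.hasFDerivAt.comp_hasDerivAt t hf).clm_apply hg
    exact this
  -- crossed homomorphism property
  have cross : ∀ t x y, φ t (b x y) = p x (φ t y) - p y (φ t x) + n (φ t x) (φ t y) := by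
    intro t x y
    have := pl_exp_zero (LinearMap.toContinuousLinearMap (n v))
      (fun t => φ t (b x y) - (p x (φ t y) - p y (φ t x) + n (φ t x) (φ t y))) (by
        intro t
        have := (hφ (b x y) t).fun_sub ((((lin (p x) _ _ t (hφ y t)).fun_sub
          (lin (p y) _ _ t (hφ x t))).fun_add (bil _ _ _ _ t (hφ x t) (hφ y t))))
        convert this using 1
        simp only [LinearMap.coe_toContinuousLinearMap', map_sub, map_add, h2, h3,
          LinearMap.sub_apply]
        rw [hjac v (φ t x) (φ t y)]
        rw [hanti (φ t x) (p y v)]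
        abel) (by simp [hφ0, h1]) t
    exact sub_eq_zero.1 this
  let B := Module.finBasis ℂ V
  let M : ℂ → Matrix _ _ ℂ := fun t => LinearMap.toMatrix B B (φ t)
  have hMder : ∀ t i j, HasDerivAt (fun s => M s i j)
      (LinearMap.toMatrix B B (n v ∘ₗ φ t - p.flip v) i j) t := by
    intro t i j
    have := linq (B.coord i) _ _ t (hφ (B j) t)
    simpa [M, LinearMap.toMatrix_apply] using this
  have hsq : ∀ t, HasDerivAt (fun s => (M s).det ^ 2) 0 t := by
    intro t
    by_cases h0 : (M t).det = 0
    · have := (pl_det_formula M _ t (hMder t)).fun_pow 2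
      simpa [h0] using this
    · have hu : IsUnit (M t).det := isUnit_iff_ne_zero.2 h0
      have hu' : IsUnit (LinearMap.det (φ t)) := by
        rwa [← LinearMap.det_toMatrix B]
      let ψ := LinearEquiv.ofIsUnitDet (f := φ t) (v := B) (v' := B) hu
      have hψ : ∀ x, ψ x = φ t x := fun x => rfl
      let y := ψ.symm v
      have hy : φ t y = v := by rw [← hψ]; simp [y]
      have hder : n v ∘ₗ φ t - p.flip v = φ t ∘ₗ (b y - ψ.symm.toLinearMap ∘ₗ p y ∘ₗ ψ.toLinearMap) := by
        ext x
        have := cross t y x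
        rw [hy] at this
        simp only [LinearMap.sub_apply, LinearMap.comp_apply, map_sub, this, LinearEquiv.coe_coe, LinearMap.flip_apply]
        rw [← hψ (ψ.symm _), LinearEquiv.apply_symm_apply, hψ]
        abel
      have hz := pl_det_hasDerivAt_zero M _ (LinearMap.toMatrix B B
        (b y - ψ.symm.toLinearMap ∘ₗ p y ∘ₗ ψ.toLinearMap)) t (hMder t) (by
          rw [hder, LinearMap.toMatrix_comp B B B]) (by
          rw [← LinearMap.trace_eq_matrix_trace, map_sub, htb, LinearMap.trace_comp_comm',
            LinearMap.comp_assoc]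
          simp [htp])
      have := hz.fun_pow 2
      simpa using this
  have hdet : (M 1).det ^ 2 = (M 0).det ^ 2 := pl_const (fun s => (M s).det ^ 2) hsq 1
  have hM1 : IsUnit (M 1).det := by
    rw [isUnit_iff_ne_zero]
    intro h0
    rw [h0] at hdet
    simp [M, hφ0] at hdet
  have hsurj : Function.Surjective (φ 1) :=
    (LinearEquiv.ofIsUnitDet (f := φ 1) (v := B) (v' := B) hM1).surjective
  have hqφ : ∀ x, q (φ 1 x) = 0 := by
    intro x
    have := pl_const (fun s => q (φ s x) + s * q (p x v)) (fun t => by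
      have := (linq q _ _ t (hφ x t)).fun_add ((hasDerivAt_id t).mul_const (q (p x v)))
      simpa [hqn] using this) 1
    simp [hφ0] at this
    rw [← hq x] at this
    simpa using this
  ext w
  obtain ⟨x, rfl⟩ := hsurj w
  simp [hqφ]
end

theorem pl_flow_contra' {V : Type*} [AddCommGroup V] [Module ℂ V] [FiniteDimensional ℂ V]
    (p n b : V →ₗ[ℂ] V →ₗ[ℂ] V)
    (hanti : ∀ x y, n x y = - n y x)
    (hjac : ∀ x y z, n x (n y z) = n (n x y) z + n y (n x z))
    (h1 : ∀ x y, b x y = p x y - p y x + n x y)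
    (h2 : ∀ x y z, p (b x y) z = p x (p y z) - p y (p x z))
    (h3 : ∀ x y z, p x (n y z) = n (p x y) z + n y (p x z))
    (htb : ∀ x, LinearMap.trace ℂ V (b x) = 0)
    (htp : ∀ x, LinearMap.trace ℂ V (p x) = 0)
    (v : V) (q : V →ₗ[ℂ] ℂ) (hqn : ∀ u w, q (n u w) = 0) (hq : ∀ x, q x = q (p x v)) :
    q = 0 := by
  let i1 : NormedAddCommGroup V := NormedAddCommGroup.induced V
    (Fin (Module.finrank ℂ V) → ℂ) (Module.finBasis ℂ V).equivFun
    (Module.finBasis ℂ V).equivFun.injective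
  let i2 : NormedSpace ℂ V := NormedSpace.induced ℂ V
    (Fin (Module.finrank ℂ V) → ℂ) (Module.finBasis ℂ V).equivFun
  exact pl_flow_contra p n b hanti hjac h1 h2 h3 htb htp v q hqn hq

section whitehead
variable {G M : Type*} [LieRing G] [LieAlgebra ℂ G] [Module.Finite ℂ G]

theorem pl_simple_perfect (hs : LieAlgebra.IsSimple ℂ G) :
    ⁅(⊤ : LieIdeal ℂ G), (⊤ : LieIdeal ℂ G)⁆ = ⊤ := by
  rcases hs.eq_bot_or_eq_top ⁅(⊤ : LieIdeal ℂ G), (⊤ : LieIdeal ℂ G)⁆ with h | h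
  · exfalso
    apply hs.non_abelian
    rw [LieSubmodule.lie_eq_bot_iff] at h
    exact ⟨fun x y => h x trivial y trivial⟩
  · exact h

theorem pl_perfect_zero (hs : LieAlgebra.IsSimple ℂ G) {W : Type*} [AddCommGroup W] [Module ℂ W]
    (l : G →ₗ[ℂ] W) (h : ∀ x y : G, l ⁅x, y⁆ = 0) (x : G) : l x = 0 := by
  have h1 := congrArg LieSubmodule.toSubmodule (pl_simple_perfect hs)
  rw [LieSubmodule.lieIdeal_oper_eq_linear_span', LieSubmodule.top_toSubmodule] at h1
  have h2 : x ∈ Submodule.span ℂ {y : G | ∃ a ∈ (⊤ : LieIdeal ℂ G), ∃ b ∈ (⊤ : LieIdeal ℂ G),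
      ⁅a, b⁆ = y} := by
    rw [h1]; trivial
  have h3 : Submodule.span ℂ {y : G | ∃ a ∈ (⊤ : LieIdeal ℂ G), ∃ b ∈ (⊤ : LieIdeal ℂ G),
      ⁅a, b⁆ = y} ≤ LinearMap.ker l := by
    rw [Submodule.span_le]
    rintro _ ⟨a, _, b, _, rfl⟩
    exact h a b
  exact h3 h2

theorem pl_casimir {W ι : Type*} [AddCommGroup W] [Module ℂ W] [Fintype ι] [DecidableEq ι]
    (B : LinearMap.BilinForm ℂ G) (hB : B.Nondegenerate)
    (hinv : ∀ x y z, B ⁅x, y⁆ z = B x ⁅y, z⁆) (b : Module.Basis ι ℂ G)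
    (F : G →ₗ[ℂ] G →ₗ[ℂ] W) (x : G) :
    ∑ i, F ⁅x, b i⁆ (B.dualBasis hB b i) = - ∑ i, F (b i) ⁅x, B.dualBasis hB b i⁆ := by
  set c := B.dualBasis hB b with hc
  have hcb : ∀ i j, B (c i) (b j) = if j = i then 1 else 0 :=
    LinearMap.BilinForm.apply_dualBasis_left hB b
  -- expansions
  have e1 : ∀ y, y = ∑ j, B (c j) y • b j := by
    intro y
    conv_lhs => rw [← b.sum_repr y]
    refine Finset.sum_congr rfl fun j _ => ?_
    congr 1
    have := congrArg (B (c j)) (b.sum_repr y)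
    simp only [map_sum, map_smul, LinearMap.sum_apply, LinearMap.smul_apply, hcb] at this
    simpa using this
  have e2 : ∀ y, y = ∑ j, B y (b j) • c j := by
    intro y
    conv_lhs => rw [← c.sum_repr y]
    refine Finset.sum_congr rfl fun j _ => ?_
    congr 1
    have := congrArg (fun z => B z (b j)) (c.sum_repr y)
    simp only [map_sum, map_smul, LinearMap.sum_apply, LinearMap.smul_apply, hcb] at this
    simpa using this
  have l1 : ∀ i, F ⁅x, b i⁆ (c i) = ∑ j, B (c j) ⁅x, b i⁆ • F (b j) (c i) := by
    intro i
    conv_lhs => rw [e1 ⁅x, b i⁆]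
    simp
  have l2 : ∀ i, F (b i) ⁅x, c i⁆ = ∑ j, B ⁅x, c i⁆ (b j) • F (b i) (c j) := by
    intro i
    conv_lhs => rw [e2 ⁅x, c i⁆]
    simp
  simp_rw [l1, l2]
  rw [Finset.sum_comm, ← Finset.sum_neg_distrib]
  refine Finset.sum_congr rfl fun i _ => ?_
  rw [← Finset.sum_neg_distrib]
  refine Finset.sum_congr rfl fun j _ => ?_
  rw [← neg_smul]
  congr 1
  rw [← hinv, ← lie_skew, map_neg, LinearMap.neg_apply]

variable [AddCommGroup M] [Module ℂ M] [FiniteDimensional ℂ M] [LieRingModule G M]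
  [LieModule ℂ G M]

theorem pl_trivial_or (hs : LieAlgebra.IsSimple ℂ G) [LieModule.IsIrreducible ℂ G M] :
    (∀ (x : G) (m : M), ⁅x, m⁆ = 0) ∨ (LieModule.traceForm ℂ G M).Nondegenerate := by
  have hrefl := (LieModule.traceForm_isSymm ℂ G M).isRefl
  let K : LieIdeal ℂ G :=
    { LinearMap.ker (LieModule.traceForm ℂ G M) with
      lie_mem := by
        intro x m hm
        have hm' : LieModule.traceForm ℂ G M m = 0 := hm
        change LieModule.traceForm ℂ G M ⁅x, m⁆ = 0
        ext z
        rw [← lie_skew, map_neg, LinearMap.neg_apply, LieModule.traceForm_apply_lie_apply, hm']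
        simp }
  have hK : ∀ x, x ∈ K ↔ LieModule.traceForm ℂ G M x = 0 := fun x => Iff.rfl
  rcases hs.eq_bot_or_eq_top K with h | h
  · right
    refine hrefl.nondegenerate_iff_separatingLeft.2 ?_
    rw [LinearMap.separatingLeft_iff_ker_eq_bot,
      Submodule.eq_bot_iff]
    intro x hx
    have : x ∈ K := hx
    rw [h] at this
    simpa using this
  · left
    have h0 : LieModule.traceForm ℂ G M = 0 := by
      refine LinearMap.ext fun x => ?_
      exact (hK x).1 (h ▸ trivial)
    have hn := LieModule.isNilpotent_derivedSeries_of_traceForm_eq_zero h0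
    have hD : LieAlgebra.derivedSeries ℂ G 1 = ⊤ := by
      rw [LieAlgebra.derivedSeries_def, LieAlgebra.derivedSeriesOfIdeal_succ,
        LieAlgebra.derivedSeriesOfIdeal_zero]
      exact pl_simple_perfect hs
    have hn2 : LieModule.IsNilpotent G M := by
      rw [LieModule.isNilpotent_iff_forall' (R := ℂ)] at hn ⊢
      intro x
      exact hn ⟨x, hD ▸ trivial⟩
    have : Nontrivial M := LieModule.nontrivial_of_isIrreducible ℂ G M
    have h3 := LieModule.nontrivial_max_triv_of_isNilpotent ℂ G M
    have h4 := LieSubmodule.eq_top_of_isIrreducible ℂ G M (LieModule.maxTrivSubmodule ℂ G M)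
    intro x m
    have : m ∈ LieModule.maxTrivSubmodule ℂ G M := h4 ▸ trivial
    exact (LieModule.mem_maxTrivSubmodule ℂ G M m).1 this x

theorem pl_whitehead (hs : LieAlgebra.IsSimple ℂ G) [LieModule.IsIrreducible ℂ G M]
    (φ : G →ₗ[ℂ] M) (hφ : ∀ x y, φ ⁅x, y⁆ = ⁅x, φ y⁆ - ⁅y, φ x⁆) :
    ∃ v : M, ∀ x, φ x = ⁅x, v⁆ := by
  rcases pl_trivial_or (M := M) hs with h | hB
  · refine ⟨0, fun x => ?_⟩
    rw [lie_zero]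
    exact pl_perfect_zero hs φ (fun x y => by rw [hφ, h, h, sub_zero]) x
  set B := LieModule.traceForm ℂ G M with hBdef
  let b := Module.finBasis ℂ G
  set c := B.dualBasis hB b with hc
  have hinv : ∀ x y z, B ⁅x, y⁆ z = B x ⁅y, z⁆ := LieModule.traceForm_apply_lie_apply ℂ G M
  let C : M →ₗ[ℂ] M := ∑ i, LieModule.toEnd ℂ G M (b i) * LieModule.toEnd ℂ G M (c i)
  have hC : ∀ m, C m = ∑ i, ⁅b i, ⁅c i, m⁆⁆ := by intro m; simp [C]
  have hcomm : ∀ (x : G) m, ⁅x, C m⁆ = C ⁅x, m⁆ := by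
    intro x m
    have := pl_casimir B hB hinv b ((LieModule.toEnd ℂ G M : G →ₗ[ℂ] Module.End ℂ M).compl₂
      ((LieModule.toEnd ℂ G M : G →ₗ[ℂ] Module.End ℂ M).flip m)) x
    simp only [LinearMap.compl₂_apply, LinearMap.flip_apply, LieHom.coe_toLinearMap,
      LieModule.toEnd_apply_apply, ← hc] at this
    simp only [hC, lie_sum]
    have e : ∀ i, ⁅x, ⁅b i, ⁅c i, m⁆⁆⁆ = ⁅⁅x, b i⁆, ⁅c i, m⁆⁆ +
        (⁅b i, ⁅⁅x, c i⁆, m⁆⁆ + ⁅b i, ⁅c i, ⁅x, m⁆⁆⁆) := by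
      intro i
      rw [leibniz_lie x (b i), leibniz_lie x (c i) m, lie_add]
    simp only [e, Finset.sum_add_distrib, this]
    abel
  let v0 : M := ∑ i, ⁅b i, φ (c i)⁆
  have hv0 : ∀ x : G, ⁅x, v0⁆ = C (φ x) := by
    intro x
    have := pl_casimir B hB hinv b
      ((LieModule.toEnd ℂ G M : G →ₗ[ℂ] Module.End ℂ M).compl₂ φ) x
    simp only [LinearMap.compl₂_apply, LieHom.coe_toLinearMap,
      LieModule.toEnd_apply_apply, ← hc] at this
    simp only [hC, lie_sum, v0]
    have e : ∀ i, ⁅x, ⁅b i, φ (c i)⁆⁆ = ⁅⁅x, b i⁆, φ (c i)⁆ +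
        (⁅b i, φ ⁅x, c i⁆⁆ + ⁅b i, ⁅c i, φ x⁆⁆) := by
      intro i
      rw [leibniz_lie x (b i), hφ, lie_sub]
      abel
    simp only [e, Finset.sum_add_distrib, this]
    abel
  have htr : LinearMap.trace ℂ M C = Module.finrank ℂ G := by
    simp only [C, map_sum]
    have : ∀ i, LinearMap.trace ℂ M (LieModule.toEnd ℂ G M (b i) * LieModule.toEnd ℂ G M (c i))
        = 1 := by
      intro i
      have h1 : B (b i) (c i) = 1 := by
        rw [hBdef, LieModule.traceForm_comm, hc]
        simpa using LinearMap.BilinForm.apply_dualBasis_left hB b i i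
      exact h1
    simp [this]
  have hG : Nontrivial G := LieAlgebra.IsSimple.nontrivial ℂ G
  have hker : LinearMap.ker C = ⊥ := by
    let K : LieSubmodule ℂ G M :=
      { LinearMap.ker C with
        lie_mem := by
          intro x m hm
          have hm' : C m = 0 := hm
          change C ⁅x, m⁆ = 0
          rw [← hcomm, hm', lie_zero] }
    rcases IsSimpleOrder.eq_bot_or_eq_top K with h | h
    · rw [Submodule.eq_bot_iff]
      intro x hx
      have : x ∈ K := hx
      rw [h] at this
      simpa using this
    · exfalso
      have : C = 0 := by
        ext m
        have : m ∈ K := h ▸ trivial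
        exact this
      rw [this, map_zero] at htr
      have := Module.finrank_pos (R := ℂ) (M := G)
      have h5 : Module.finrank ℂ G = 0 := by exact_mod_cast htr.symm
      omega
  have hinj : Function.Injective C := LinearMap.ker_eq_bot.1 hker
  have hsurj : Function.Surjective C := LinearMap.injective_iff_surjective.1 hinj
  obtain ⟨v, hv⟩ := hsurj v0
  refine ⟨v, fun x => hinj ?_⟩
  rw [← hcomm, hv, hv0]
end whitehead

section assembly
variable {G M : Type*} [LieRing G] [LieAlgebra ℂ G] [Module.Finite ℂ G]
  [LieRing M] [LieAlgebra ℂ M] [Module.Finite ℂ M]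

theorem pl_killing_stable (D : Module.End ℂ M)
    (hD : ∀ a b : M, D ⁅a, b⁆ = ⁅D a, b⁆ + ⁅a, D b⁆) (m : M)
    (hm : m ∈ LieIdeal.killingCompl ℂ M ⊤) : D m ∈ LieIdeal.killingCompl ℂ M ⊤ := by
  rw [LieIdeal.mem_killingCompl] at hm ⊢
  intro y _
  have h1 := hm (D y) trivial
  rw [killingForm_apply_apply] at h1 ⊢
  have e : ∀ a, (LieAlgebra.ad ℂ M (D a) : Module.End ℂ M) =
      D * LieAlgebra.ad ℂ M a - LieAlgebra.ad ℂ M a * D := by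
    intro a
    ext z
    simp [hD]
  rw [e] at h1 ⊢
  set A : Module.End ℂ M := LieAlgebra.ad ℂ M y
  set B : Module.End ℂ M := LieAlgebra.ad ℂ M m
  change LinearMap.trace ℂ M ((D * A - A * D) * B) = 0 at h1
  change LinearMap.trace ℂ M (A * (D * B - B * D)) = 0
  have h2 : LinearMap.trace ℂ M (D * A * B) = LinearMap.trace ℂ M (A * B * D) := by
    rw [mul_assoc, LinearMap.trace_mul_comm]
  rw [sub_mul, map_sub, h2] at h1
  rw [mul_sub, map_sub, ← mul_assoc, ← mul_assoc, ← neg_sub, h1, neg_zero]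

theorem pl_derived_stable (D : Module.End ℂ M)
    (hD : ∀ a b : M, D ⁅a, b⁆ = ⁅D a, b⁆ + ⁅a, D b⁆) (m : M)
    (hm : m ∈ ⁅(⊤ : LieIdeal ℂ M), (⊤ : LieIdeal ℂ M)⁆) :
    D m ∈ ⁅(⊤ : LieIdeal ℂ M), (⊤ : LieIdeal ℂ M)⁆ := by
  rw [← LieSubmodule.mem_toSubmodule, LieSubmodule.lieIdeal_oper_eq_linear_span'] at hm
  induction hm using Submodule.span_induction with
  | mem x h =>
    obtain ⟨a, _, b, _, rfl⟩ := h
    rw [hD]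
    exact add_mem (LieSubmodule.lie_mem_lie trivial trivial)
      (LieSubmodule.lie_mem_lie trivial trivial)
  | zero => rw [map_zero]; exact zero_mem _
  | add x y _ _ hx hy => rw [map_add]; exact add_mem hx hy
  | smul c x _ hx => rw [map_smul]; exact SMulMemClass.smul_mem c hx

theorem pl_killing_or_abelian [Nontrivial M] (δ : G →ₗ[ℂ] Module.End ℂ M)
    (hder : ∀ x (a b : M), δ x ⁅a, b⁆ = ⁅δ x a, b⁆ + ⁅a, δ x b⁆)
    (hmin : ∀ J : LieIdeal ℂ M, (∀ x, ∀ m ∈ J, δ x m ∈ J) → J = ⊥ ∨ J = ⊤) :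
    LieAlgebra.IsKilling ℂ M ∨ ∀ a b : M, ⁅a, b⁆ = 0 := by
  rcases hmin (LieIdeal.killingCompl ℂ M ⊤) (fun x m hm => pl_killing_stable (δ x) (hder x) m hm)
    with h | h
  · exact Or.inl ⟨h⟩
  · right
    have h1 := LieAlgebra.killingCompl_top_le_radical ℂ M
    rw [h, top_le_iff] at h1
    have hsol : LieAlgebra.IsSolvable M := by
      have := LieAlgebra.radicalIsSolvable ℂ M
      rw [h1] at this
      exact (LieAlgebra.solvable_iff_equiv_solvable (R := ℂ) LieSubalgebra.topEquiv).1 this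
    rcases hmin ⁅(⊤ : LieIdeal ℂ M), (⊤ : LieIdeal ℂ M)⁆
      (fun x m hm => pl_derived_stable (δ x) (hder x) m hm) with h2 | h2
    · rw [LieSubmodule.lie_eq_bot_iff] at h2
      exact fun a b => h2 a trivial b trivial
    · exfalso
      have h3 := LieAlgebra.derivedSeries_lt_top_of_solvable (R := ℂ) (L := M)
      rw [LieAlgebra.derivedSeries_def, LieAlgebra.derivedSeriesOfIdeal_succ,
        LieAlgebra.derivedSeriesOfIdeal_zero, h2] at h3
      exact lt_irrefl _ h3

theorem pl_abelian_cocycle (hs : LieAlgebra.IsSimple ℂ G) [Nontrivial M]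
    (δ : G →ₗ[ℂ] Module.End ℂ M)
    (hrep : ∀ (x y : G) m, δ ⁅x, y⁆ m = δ x (δ y m) - δ y (δ x m))
    (hmin : ∀ J : LieIdeal ℂ M, (∀ x, ∀ m ∈ J, δ x m ∈ J) → J = ⊥ ∨ J = ⊤)
    (hab : ∀ a b : M, ⁅a, b⁆ = 0)
    (φ : G →ₗ[ℂ] M) (hφ : ∀ x y : G, φ ⁅x, y⁆ = δ x (φ y) - δ y (φ x) + ⁅φ x, φ y⁆) :
    ∃ v, ∀ x, φ x = δ x v := by
  let i1 : LieRingModule G M :=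
    { bracket := fun x m => δ x m
      add_lie := fun x y m => by change δ (x + y) m = δ x m + δ y m; simp
      lie_add := fun x m n => by change δ x (m + n) = δ x m + δ x n; simp
      leibniz_lie := fun x y m => by
        change δ x (δ y m) = δ ⁅x, y⁆ m + δ y (δ x m)
        rw [hrep]; abel }
  have hb : ∀ (x : G) (m : M), ⁅x, m⁆ = δ x m := fun x m => rfl
  have i2 : LieModule ℂ G M :=
    { smul_lie := fun t x m => by simp [hb]
      lie_smul := fun t x m => by simp [hb] }
  have i3 : LieModule.IsIrreducible ℂ G M := by
    apply LieModule.IsIrreducible.mk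
    intro N hN
    let J : LieIdeal ℂ M :=
      { N.toSubmodule with
        lie_mem := by
          intro x m _
          rw [hab]
          exact zero_mem N }
    have hJ : ∀ m, m ∈ J ↔ m ∈ N := fun m => Iff.rfl
    rcases hmin J (fun x m hm => N.lie_mem (x := x) hm) with h | h
    · exact absurd ((LieSubmodule.eq_bot_iff N).2 fun m hm => by
        have := (hJ m).2 hm
        rw [h] at this
        simpa using this) hN
    · rw [eq_top_iff]
      intro m _
      exact (hJ m).1 (h ▸ trivial)
  exact pl_whitehead (M := M) hs φ (fun x y => by rw [hφ, hab, add_zero, hb, hb])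

theorem pl_killing_hom [LieAlgebra.IsKilling ℂ M] (δ : G →ₗ[ℂ] Module.End ℂ M)
    (hrep : ∀ (x y : G) m, δ ⁅x, y⁆ m = δ x (δ y m) - δ y (δ x m))
    (hder : ∀ x (a b : M), δ x ⁅a, b⁆ = ⁅δ x a, b⁆ + ⁅a, δ x b⁆)
    (φ : G →ₗ[ℂ] M) (hφ : ∀ x y : G, φ ⁅x, y⁆ = δ x (φ y) - δ y (φ x) + ⁅φ x, φ y⁆)
    (hφ0 : φ ≠ 0) : ∃ f : G →ₗ⁅ℂ⁆ M, ∃ x, f x ≠ 0 := by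
  have hin : ∀ x, ∃ m : M, ∀ z, δ x z = ⁅m, z⁆ := by
    intro x
    obtain ⟨m, hm⟩ := LieDerivation.IsKilling.exists_eq_ad (R := ℂ) (L := M)
      { toLinearMap := δ x
        leibniz' := fun a b => by
          rw [hder, ← lie_skew b (δ x a)]; abel }
    refine ⟨m, fun z => ?_⟩
    have := congrArg (fun D => D z) hm
    simpa using this.symm
  choose ρ hρ using hin
  have huniq : ∀ m m' : M, (∀ z : M, ⁅m, z⁆ = ⁅m', z⁆) → m = m' := by
    intro m m' h
    have : m - m' ∈ LieAlgebra.center ℂ M := by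
      rw [LieModule.mem_maxTrivSubmodule]
      intro z
      rw [← lie_skew, sub_lie, h, sub_self, neg_zero]
    rw [LieAlgebra.center_eq_bot, LieSubmodule.mem_bot] at this
    exact sub_eq_zero.1 this
  let r : G →ₗ[ℂ] M :=
    { toFun := ρ
      map_add' := fun x y => huniq _ _ fun z => by rw [← hρ, add_lie, ← hρ, ← hρ]; simp
      map_smul' := fun t x => huniq _ _ fun z => by rw [← hρ, smul_lie, RingHom.id_apply, ← hρ]; simp }
  have hr : ∀ x z, δ x z = ⁅r x, z⁆ := hρ
  have hr2 : ∀ x y : G, r ⁅x, y⁆ = ⁅r x, r y⁆ := fun x y => huniq _ _ fun z => by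
    rw [← hr, hrep, hr, hr, hr, hr, lie_lie]
  let f1 : G →ₗ⁅ℂ⁆ M := { r with map_lie' := fun {x y} => hr2 x y }
  let f2 : G →ₗ⁅ℂ⁆ M := { r + φ with
    map_lie' := fun {x y} => by
      change r ⁅x, y⁆ + φ ⁅x, y⁆ = ⁅r x + φ x, r y + φ y⁆
      rw [hφ, hr2, hr, hr, lie_add, add_lie, add_lie, ← lie_skew (φ x) (r y)]
      abel }
  by_contra hcon
  push Not at hcon
  apply hφ0
  ext x
  have a1 : r x = 0 := hcon f1 x
  have a2 : r x + φ x = 0 := hcon f2 x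
  rw [a1, zero_add] at a2
  simpa using a2

theorem pl_simple_inj (hs : LieAlgebra.IsSimple ℂ G) (f : G →ₗ⁅ℂ⁆ M) (hf : ∃ x, f x ≠ 0) :
    Function.Injective f := by
  rcases hs.eq_bot_or_eq_top f.ker with h | h
  · exact (LieHom.ker_eq_bot f).1 h
  · obtain ⟨x, hx⟩ := hf
    exact absurd ((LieHom.mem_ker (f := f) (x := x)).1 (h ▸ trivial)) hx

theorem pl_exists_max [Nontrivial M] (P : G → Module.End ℂ M) :
    ∃ I : LieIdeal ℂ M, I ≠ ⊤ ∧ (∀ x, ∀ m ∈ I, P x m ∈ I) ∧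
      ∀ J : LieIdeal ℂ M, I ≤ J → (∀ x, ∀ m ∈ J, P x m ∈ J) → J = I ∨ J = ⊤ := by
  have hne : ({I : LieIdeal ℂ M | I ≠ ⊤ ∧ ∀ x, ∀ m ∈ I, P x m ∈ I}).Nonempty :=
    ⟨⊥, bot_ne_top, fun x m hm => by
      rw [LieSubmodule.mem_bot] at hm ⊢
      rw [hm, map_zero]⟩
  have wf : WellFoundedGT (LieIdeal ℂ M) := inferInstance
  obtain ⟨I, hI, hmax⟩ := wf.wf.has_min _ hne
  refine ⟨I, hI.1, hI.2, fun J hIJ hJ => ?_⟩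
  by_contra hcon
  push Not at hcon
  exact hmax J ⟨hcon.2, hJ⟩ (lt_of_le_of_ne hIJ (Ne.symm hcon.1))

end assembly

/-- Let `g` and `n` be two Lie algebra structures on the same
finite-dimensional complex vector space (formalized as Lie algebras `G`, `N` together
with a linear equivalence `e : G ≃ₗ[ℂ] N` identifying the underlying vector spaces),
where `g` is simple. If there is a post-Lie algebra structure on the pair `(g, n)`,
i.e. a bilinear product `p` satisfying the three post-Lie axioms, then `n` is
isomorphic to `g` as a Lie algebra. -/
theorem postLie_g_simple_implies_iso
    {G N : Type*} [LieRing G] [LieAlgebra ℂ G] [Module.Finite ℂ G]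
    [LieRing N] [LieAlgebra ℂ N]
    (e : G ≃ₗ[ℂ] N)
    (hsimple : LieAlgebra.IsSimple ℂ G)
    (p : G →ₗ[ℂ] G →ₗ[ℂ] G)
    (hax1 : ∀ x y : G, p x y - p y x = ⁅x, y⁆ - e.symm ⁅e x, e y⁆)
    (hax2 : ∀ x y z : G, p ⁅x, y⁆ z = p x (p y z) - p y (p x z))
    (hax3 : ∀ x y z : G,
      p x (e.symm ⁅e y, e z⁆) = e.symm ⁅e (p x y), e z⁆ + e.symm ⁅e y, e (p x z)⁆) :
    Nonempty (G ≃ₗ⁅ℂ⁆ N) := by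
  have hfin : Module.Finite ℂ N := Module.Finite.equiv e
  have hG : Nontrivial G := LieAlgebra.IsSimple.nontrivial ℂ G
  have hN : Nontrivial N := e.symm.toEquiv.nontrivial
  -- transported action
  let D : G →ₗ[ℂ] Module.End ℂ N := e.conj.toLinearMap ∘ₗ p
  have hD : ∀ x m, D x m = e (p x (e.symm m)) := fun x m => rfl
  have hDder : ∀ x (a b : N), D x ⁅a, b⁆ = ⁅D x a, b⁆ + ⁅a, D x b⁆ := by
    intro x a b
    have := congrArg e (hax3 x (e.symm a) (e.symm b))
    simpa [hD] using this
  have hDrep : ∀ (x y : G) m, D ⁅x, y⁆ m = D x (D y m) - D y (D x m) := by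
    intro x y m
    simp [hD, hax2]
  have hcross : ∀ x y : G, e ⁅x, y⁆ = D x (e y) - D y (e x) + ⁅e x, e y⁆ := by
    intro x y
    have := congrArg e (hax1 x y)
    simp only [map_sub, LinearEquiv.apply_symm_apply] at this
    simp only [hD, LinearEquiv.symm_apply_apply]
    rw [this]; abel
  obtain ⟨I, hItop, hIst, hImax⟩ := pl_exists_max (fun x => D x)
  let π : N →ₗ⁅ℂ⁆ N ⧸ I :=
    { (LieSubmodule.Quotient.mk' I : N →ₗ[ℂ] N ⧸ I) with
      map_lie' := fun {x y} => LieSubmodule.Quotient.mk_bracket _ x y }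
  have hπs : Function.Surjective π := LieSubmodule.Quotient.surjective_mk' I
  have hπ0 : ∀ m, π m = 0 ↔ m ∈ I := fun m => LieSubmodule.Quotient.mk_eq_zero I
  have hMfin : Module.Finite ℂ (N ⧸ I) := Module.Finite.of_surjective (π : N →ₗ[ℂ] N ⧸ I) hπs
  have hMnt : Nontrivial (N ⧸ I) := by
    by_contra hcon
    rw [not_nontrivial_iff_subsingleton] at hcon
    apply hItop
    rw [eq_top_iff]
    intro m _
    exact (hπ0 m).1 (Subsingleton.elim _ _)
  let δ0 : G → Module.End ℂ (N ⧸ I) := fun x =>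
    Submodule.mapQ I.toSubmodule I.toSubmodule (D x) (fun m hm => hIst x m hm)
  have hδ0 : ∀ x m, δ0 x (π m) = π (D x m) := fun x m => rfl
  let δ : G →ₗ[ℂ] Module.End ℂ (N ⧸ I) :=
    { toFun := δ0
      map_add' := fun x y => by
        refine LinearMap.ext fun m => ?_
        obtain ⟨m, rfl⟩ := hπs m
        simp [hδ0]
      map_smul' := fun t x => by
        refine LinearMap.ext fun m => ?_
        obtain ⟨m, rfl⟩ := hπs m
        simp [hδ0] }
  have hδ : ∀ x m, δ x (π m) = π (D x m) := hδ0
  have hder : ∀ x (a b : N ⧸ I), δ x ⁅a, b⁆ = ⁅δ x a, b⁆ + ⁅a, δ x b⁆ := by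
    intro x a b
    obtain ⟨a, rfl⟩ := hπs a
    obtain ⟨b, rfl⟩ := hπs b
    rw [← LieHom.map_lie, hδ, hDder, hδ, hδ, map_add, LieHom.map_lie, LieHom.map_lie]
  have hrep : ∀ (x y : G) m, δ ⁅x, y⁆ m = δ x (δ y m) - δ y (δ x m) := by
    intro x y m
    obtain ⟨m, rfl⟩ := hπs m
    simp only [hδ, hDrep, map_sub]
  have hmin : ∀ J : LieIdeal ℂ (N ⧸ I), (∀ x, ∀ m ∈ J, δ x m ∈ J) → J = ⊥ ∨ J = ⊤ := by
    intro J hJ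
    rcases hImax (J.comap π) (fun m hm => by
        rw [LieIdeal.mem_comap, (hπ0 m).2 hm]; exact zero_mem J)
      (fun x m hm => by
        rw [LieIdeal.mem_comap] at hm ⊢
        rw [← hδ]; exact hJ x _ hm) with h | h
    · left
      rw [LieSubmodule.eq_bot_iff]
      intro m hm
      obtain ⟨m, rfl⟩ := hπs m
      rw [hπ0, ← h, LieIdeal.mem_comap]
      exact hm
    · right
      rw [eq_top_iff]
      intro m _
      obtain ⟨m, rfl⟩ := hπs m
      rw [← LieIdeal.mem_comap, h]
      trivial
  let φ : G →ₗ[ℂ] N ⧸ I := (π : N →ₗ[ℂ] N ⧸ I) ∘ₗ e.toLinearMap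
  have hφa : ∀ x, φ x = π (e x) := fun x => rfl
  have hφ : ∀ x y : G, φ ⁅x, y⁆ = δ x (φ y) - δ y (φ x) + ⁅φ x, φ y⁆ := by
    intro x y
    simp only [hφa, hδ, hcross, map_add, map_sub, LieHom.map_lie]
  have hφs : Function.Surjective φ := hπs.comp e.surjective
  rcases pl_killing_or_abelian δ hder hmin with hK | hab
  · have hφ0 : φ ≠ 0 := by
      intro h0
      obtain ⟨m, hm⟩ := exists_ne (0 : N ⧸ I)
      obtain ⟨x, rfl⟩ := hφs m
      exact hm (by rw [h0]; rfl)
    obtain ⟨f, hf⟩ := pl_killing_hom δ hrep hder φ hφ hφ0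
    have hfi := pl_simple_inj hsimple f hf
    have hd1 : Module.finrank ℂ G ≤ Module.finrank ℂ (N ⧸ I) :=
      LinearMap.finrank_le_finrank_of_injective (f := (f : G →ₗ[ℂ] N ⧸ I)) hfi
    have hd2 : Module.finrank ℂ (N ⧸ I) ≤ Module.finrank ℂ N :=
      LinearMap.finrank_le_finrank_of_surjective (f := (π : N →ₗ[ℂ] N ⧸ I)) hπs
    have hd3 : Module.finrank ℂ G = Module.finrank ℂ N := e.finrank_eq
    have hfs : Function.Surjective f :=
      (LinearMap.injective_iff_surjective_of_finrank_eq_finrank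
        (f := (f : G →ₗ[ℂ] N ⧸ I)) (by omega)).1 hfi
    have hπi : Function.Injective π :=
      (LinearMap.injective_iff_surjective_of_finrank_eq_finrank
        (f := (π : N →ₗ[ℂ] N ⧸ I)) (by omega)).2 hπs
    exact ⟨(LieEquiv.ofBijective f ⟨hfi, hfs⟩).trans (LieEquiv.ofBijective π ⟨hπi, hπs⟩).symm⟩
  · exfalso
    obtain ⟨w, hw⟩ := pl_abelian_cocycle hsimple δ hrep hmin hab φ hφ
    obtain ⟨v, rfl⟩ := hφs w
    obtain ⟨m, hm⟩ := exists_ne (0 : N ⧸ I)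
    obtain ⟨l, hl⟩ : ∃ l : Module.Dual ℂ (N ⧸ I), l m ≠ 0 := by
      by_contra hcon
      push Not at hcon
      exact hm ((Module.forall_dual_apply_eq_zero_iff ℂ m).1 hcon)
    have hpb : ∀ x y z : G, p ⁅x, y⁆ z = p x (p y z) - p y (p x z) := hax2
    let nn : G →ₗ[ℂ] G →ₗ[ℂ] G := LinearMap.mk₂ ℂ (fun x y => e.symm ⁅e x, e y⁆)
      (by intros; simp) (by intros; simp) (by intros; simp) (by intros; simp)
    have hnn : ∀ x y, nn x y = e.symm ⁅e x, e y⁆ := fun x y => rfl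
    let bb : G →ₗ[ℂ] G →ₗ[ℂ] G := LinearMap.mk₂ ℂ (fun x y => ⁅x, y⁆)
      (by intros; simp) (by intros; simp) (by intros; simp) (by intros; simp)
    have hbb : ∀ x y, bb x y = ⁅x, y⁆ := fun x y => rfl
    have htrace : ∀ r : G →ₗ[ℂ] Module.End ℂ G,
        (∀ x y z : G, r ⁅x, y⁆ z = r x (r y z) - r y (r x z)) →
        ∀ x, LinearMap.trace ℂ G (r x) = 0 := by
      intro r hr x
      refine pl_perfect_zero hsimple (LinearMap.trace ℂ G ∘ₗ r) (fun x y => ?_) x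
      have : r ⁅x, y⁆ = r x * r y - r y * r x := by
        ext z
        simp [hr]
      rw [LinearMap.comp_apply, this, map_sub, LinearMap.trace_mul_comm, sub_self]
    have hq := pl_flow_contra' p nn bb
      (fun x y => by rw [hnn, hnn, ← lie_skew, map_neg])
      (fun x y z => by
        simp only [hnn, LinearEquiv.apply_symm_apply]
        rw [← map_add, leibniz_lie])
      (fun x y => by rw [hax1, hnn, hbb]; abel)
      (fun x y z => hax2 x y z)
      (fun x y z => hax3 x y z)
      (htrace bb (fun x y z => by simp only [hbb, lie_lie]))
      (htrace p hax2) v (l ∘ₗ φ)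
      (fun u w => by
        simp only [LinearMap.comp_apply, hφa, hnn, LinearEquiv.apply_symm_apply, LieHom.map_lie,
          hab, map_zero])
      (fun x => by
        simp only [LinearMap.comp_apply]
        rw [hw x, hφa, hφa, hδ, hD, LinearEquiv.symm_apply_apply])
    obtain ⟨x, rfl⟩ := hφs m
    exact hl (LinearMap.congr_fun hq x)
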